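/- arXiv:1301.6875 — 3 statements merged into one kernel-verified Lean document; each statement's English description precedes it below -/
import Mathlib

section
/- Let O and O′ be maximal orders of B_p, and let x, y ∈ O^T and x′, y′ ∈ O′^T be trace-zero elements with x, y ℚ-linearly independent. Suppose x ∼ x′, y ∼ y′ and x+y ∼ x′+y′, where u ∼ v means c·u·c⁻¹ = v for some nonzero c ∈ B_p. Then there exists a nonzero c ∈ B_p with c·(ℤx + ℤy)·c⁻¹ = ℤx′ + ℤy′. -/
open scoped Quaternion

/-- The rational quaternion algebra with `i² = -p`, `j² = -q`. -/
abbrev Bq (p q : ℕ) := ℍ[ℚ, -(p : ℚ), -(q : ℚ)]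

namespace GrossPaper

variable {p q : ℕ}

/-- The (reduced) trace `Tr(x) = x + x̄` of a quaternion, as a rational number. -/
def Trq (x : Bq p q) : ℚ := 2 * x.re

/-- The (reduced) norm `Nr(x) = x·x̄` of a quaternion, as a rational number. -/
def Nrq (x : Bq p q) : ℚ := (x * star x).re

/-- The inverse of a nonzero quaternion: `c⁻¹ = star c / Nr c`. -/
noncomputable def qinv (c : Bq p q) : Bq p q := (Nrq c)⁻¹ • star c

/-- Conjugation of a set: `c S c⁻¹`. -/
noncomputable def conjSet (c : Bq p q) (S : Set (Bq p q)) : Set (Bq p q) :=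
  (fun s => c * s * qinv c) '' S

/-- An order of `B_p`: a subring (hence containing `ℤ`) which is a free `ℤ`-module of
rank 4 spanning `B_p` over `ℚ`. -/
def IsOrder (O : Subring (Bq p q)) : Prop :=
  Nonempty (Module.Basis (Fin 4) ℤ O) ∧ Submodule.span ℚ (O : Set (Bq p q)) = ⊤

/-- A maximal order: an order not properly contained in any other order. -/
def IsMaximalOrder (O : Subring (Bq p q)) : Prop :=
  IsOrder O ∧ ∀ O' : Subring (Bq p q), IsOrder O' → O ≤ O' → O' = O

/-- Two orders are of the same type if they are conjugate. -/
noncomputable def SameType (O O' : Subring (Bq p q)) : Prop :=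
  ∃ c : Bq p q, c ≠ 0 ∧ conjSet c (O : Set (Bq p q)) = (O' : Set (Bq p q))

/-- The Gross lattice `O^T = {2x - Tr(x) : x ∈ O}`. -/
def GrossLat (O : Subring (Bq p q)) : Set (Bq p q) :=
  {t | ∃ x ∈ O, t = 2 * x - algebraMap ℚ (Bq p q) (Trq x)}

/-- `SuccMin T i D` says `D` is the `i`-th successive minimum of `T`: the least real
number such that `T` contains `i` `ℚ`-linearly independent elements of norm at most `D`. -/
def SuccMin (T : Set (Bq p q)) (i : ℕ) (D : ℝ) : Prop :=
  IsLeast {r : ℝ | ∃ v : Fin i → Bq p q, (∀ n, v n ∈ T) ∧ LinearIndependent ℚ v ∧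
    ∀ n, ((Nrq (v n) : ℝ) ≤ r)} D

/-- A primitive element of the Gross lattice. -/
def Primitive (T : Set (Bq p q)) (t : Bq p q) : Prop :=
  t ∈ T ∧ t ≠ 0 ∧ ∀ (a : ℤ) (s : Bq p q), s ∈ T → t = a • s → a = 1 ∨ a = -1

/-- `k` is represented optimally by `T` : `Nr(t) = k` for some primitive `t ∈ T`. -/
def OptRep (T : Set (Bq p q)) (k : ℝ) : Prop :=
  ∃ t : Bq p q, Primitive T t ∧ (Nrq t : ℝ) = k

/-- The multiplicity `θ_T(k)`: half the number of `t ∈ T` with `Nr t = k`. -/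
noncomputable def theta (T : Set (Bq p q)) (k : ℝ) : ℚ :=
  ({t : Bq p q | t ∈ T ∧ (Nrq t : ℝ) = k}.ncard : ℚ) / 2

/-- The optimal multiplicity `θ'_T(k)`: half the number of primitive `t ∈ T` with `Nr t = k`. -/
noncomputable def thetaOpt (T : Set (Bq p q)) (k : ℝ) : ℚ :=
  ({t : Bq p q | Primitive T t ∧ (Nrq t : ℝ) = k}.ncard : ℚ) / 2

end GrossPaper

open GrossPaper

theorem aux_conj {R : Type*} [Ring R] [Algebra ℚ R] [NoZeroDivisors R] (x y y' : R) (a b t : ℚ)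
    (hxx : x * x = algebraMap ℚ R a) (hyy : y * y = algebraMap ℚ R b)
    (hyy' : y' * y' = algebraMap ℚ R b)
    (ht : x * y + y * x = algebraMap ℚ R t) (ht' : x * y' + y' * x = algebraMap ℚ R t)
    (hx0 : x ≠ 0) (hli : ∀ r s : ℚ, r • x + s • y = 0 → s = 0) :
    ∃ c : R, c ≠ 0 ∧ c * x = x * c ∧ c * y = y' * c := by
  have hR : Nontrivial R := ⟨x, 0, hx0⟩
  have ha : a ≠ 0 := by
    rintro rfl
    rw [map_zero] at hxx
    exact hx0 (mul_self_eq_zero.1 hxx)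
  simp only [Algebra.algebraMap_eq_smul_one] at *
  have e1 : ∀ v : R, x * v + v * x = t • 1 → x * (x * v - v * x) = (2 * a) • v - t • x := by
    intro v hv
    have h1 : v * x = t • 1 - x * v := by rw [← hv]; abel
    rw [h1, mul_sub, mul_sub, ← mul_assoc, hxx]
    simp only [smul_mul_assoc, one_mul, mul_smul_comm, mul_one]
    module
  have e2 : ∀ v : R, x * (x * v - v * x) = -((x * v - v * x) * x) := by
    intro v
    have h : x * x * v = v * (x * x) := by rw [hxx]; simp
    simp only [mul_sub, sub_mul, ← mul_assoc] at h ⊢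
    rw [h]; abel
  have e3 : ∀ v : R, v * v = b • 1 → x * v + v * x = t • 1 →
      (x * v - v * x) * (x * v - v * x) = (t * t - 4 * a * b) • 1 := by
    intro v hvv hv
    have h1 : v * x = t • 1 - x * v := by rw [← hv]; abel
    have h2 : (x * v) * (x * v) = t • (x * v) - (a * b) • 1 := by
      calc (x * v) * (x * v) = x * (v * x) * v := by simp only [mul_assoc]
        _ = x * (t • 1 - x * v) * v := by rw [h1]
        _ = t • (x * v) - (x * x) * (v * v) := by
          simp only [mul_sub, sub_mul, mul_smul_comm, smul_mul_assoc, mul_one, mul_assoc]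
        _ = _ := by rw [hxx, hvv]; simp [smul_smul, mul_comm]
    rw [h1]
    simp only [mul_sub, sub_mul, h2, mul_smul_comm, smul_mul_assoc, mul_one, one_mul]
    module
  have f1 := e1 y ht
  have f1' := e1 y' ht'
  have f2 := e2 y
  have f2' := e2 y'
  have f3 := e3 y hyy ht
  have f3' := e3 y' hyy' ht'
  set u := x * y - y * x with hu
  set u' := x * y' - y' * x with hu'
  have hu0 : u ≠ 0 := by
    intro h
    rw [h, mul_zero] at f1
    have := hli (-t) (2 * a) (by rw [f1]; module)
    exact ha (by linarith)
  have key : ∀ c : R, c * x = x * c → c * u = u' * c → c * y = y' * c := by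
    intro c h1 h2
    have h3 : c * (x * u) = (x * u') * c := by
      rw [← mul_assoc, h1, mul_assoc, h2, mul_assoc]
    rw [f1, f1'] at h3
    simp only [mul_sub, sub_mul, mul_smul_comm, smul_mul_assoc, h1] at h3
    have h4 : (2 * a) • (c * y) = (2 * a) • (y' * c) := by simpa using h3
    exact smul_right_injective R (mul_ne_zero two_ne_zero ha) h4
  by_cases hs : u' + u = 0
  · refine ⟨x, hx0, rfl, key x rfl ?_⟩
    have : u' = -u := eq_neg_of_add_eq_zero_left hs
    rw [this, f2]; simp
  · have g1 : (u' + u) * u * x = x * ((u' + u) * u) := by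
      have h1 : u * x = -(x * u) := by rw [f2]; simp
      have h1' : u' * x = -(x * u') := by rw [f2']; simp
      rw [mul_assoc, h1, mul_neg, ← mul_assoc, add_mul, h1, h1']
      noncomm_ring
    refine ⟨(u' + u) * u, mul_ne_zero hs hu0, g1, key _ g1 ?_⟩
    have : u' * ((u' + u) * u) = (u' * u') * u + u' * (u * u) := by noncomm_ring
    rw [this, f3', mul_assoc, f3, add_mul, ← f3]
    noncomm_ring

theorem aux_qinv (p q : ℕ) (hp : 0 < p) (hq : 0 < q) (c : Bq p q) (hc : c ≠ 0) :
    c * qinv c = 1 ∧ qinv c * c = 1 := by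
  have hp' : (0 : ℚ) < p := by exact_mod_cast hp
  have hq' : (0 : ℚ) < q := by exact_mod_cast hq
  have hn : Nrq c = c.re ^ 2 + p * c.imI ^ 2 + q * c.imJ ^ 2 + p * q * c.imK ^ 2 := by
    simp [Nrq]; ring
  have hn0 : Nrq c ≠ 0 := by
    intro h
    rw [hn] at h
    have h1 := sq_nonneg c.re
    have h2 := mul_nonneg hp'.le (sq_nonneg c.imI)
    have h3 := mul_nonneg hq'.le (sq_nonneg c.imJ)
    have h4 := mul_nonneg (mul_pos hp' hq').le (sq_nonneg c.imK)
    have k1 : c.re ^ 2 = 0 := by linarith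
    have k2 : p * c.imI ^ 2 = 0 := by linarith
    have k3 : q * c.imJ ^ 2 = 0 := by linarith
    have k4 : p * q * c.imK ^ 2 = 0 := by linarith
    apply hc
    ext
    · simpa using k1
    · simpa [hp'.ne'] using k2
    · simpa [hq'.ne'] using k3
    · simpa [hp'.ne', hq'.ne'] using k4
  have m1 : c * star c = (Nrq c) • 1 := by
    rw [hn]; ext <;> simp <;> ring
  have m2 : star c * c = (Nrq c) • 1 := by
    rw [hn]; ext <;> simp <;> ring
  constructor
  · rw [qinv, mul_smul_comm, m1, smul_smul, inv_mul_cancel₀ hn0, one_smul]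
  · rw [qinv, smul_mul_assoc, m2, smul_smul, inv_mul_cancel₀ hn0, one_smul]

theorem aux_sq (p q : ℕ) (z : Bq p q) (hz : Trq z = 0) :
    z * z = algebraMap ℚ (Bq p q) (-(Nrq z)) := by
  have h : z.re = 0 := by simpa [Trq] using hz
  rw [Algebra.algebraMap_eq_smul_one]
  ext <;> simp [Nrq, h] <;> ring

/-- Lemma sim: pairwise conjugate generators give conjugate lattices. -/
theorem conj_sublattices (p q : ℕ) (hp : Nat.Prime p) (hodd : Odd p) (hq : Nat.Prime q)
    (hq8 : q % 8 = 3) (hqr : ∃ r : ℤ, (q : ℤ) ∣ r ^ 2 + p)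
    (O O' : Subring (Bq p q)) (hO : IsMaximalOrder O) (hO' : IsMaximalOrder O')
    (x y x' y' : Bq p q)
    (hx : x ∈ GrossLat O) (hy : y ∈ GrossLat O)
    (hx' : x' ∈ GrossLat O') (hy' : y' ∈ GrossLat O')
    (htx : Trq x = 0) (hty : Trq y = 0) (htx' : Trq x' = 0) (hty' : Trq y' = 0)
    (hxy : LinearIndependent ℚ ![x, y])
    (hsimx : ∃ c : Bq p q, c ≠ 0 ∧ c * x * qinv c = x')
    (hsimy : ∃ c : Bq p q, c ≠ 0 ∧ c * y * qinv c = y')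
    (hsimxy : ∃ c : Bq p q, c ≠ 0 ∧ c * (x + y) * qinv c = x' + y') :
    ∃ c : Bq p q, c ≠ 0 ∧
      conjSet c {t : Bq p q | ∃ a b : ℤ, t = a • x + b • y}
        = {t : Bq p q | ∃ a b : ℤ, t = a • x' + b • y'} := by
  have inv := fun c hc => aux_qinv p q hp.pos hq.pos c hc
  haveI : NoZeroDivisors (Bq p q) := ⟨by
    intro a b hab
    by_contra! h
    apply h.2
    rw [← one_mul b, ← (inv a h.1).2, mul_assoc, hab, mul_zero]⟩
  have hsq : ∀ z z' : Bq p q, Trq z = 0 → (∃ c : Bq p q, c ≠ 0 ∧ c * z * qinv c = z') →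
      z' * z' = z * z := by
    rintro z _ hz ⟨c, hc, rfl⟩
    calc c * z * qinv c * (c * z * qinv c) = c * z * (qinv c * c) * z * qinv c := by
          simp only [mul_assoc]
      _ = c * (z * z) * qinv c := by rw [(inv c hc).2]; simp only [mul_assoc, one_mul]
      _ = _ := by
        rw [aux_sq p q z hz, ← Algebra.commutes, mul_assoc, (inv c hc).1, mul_one]
  have htxy : Trq (x + y) = 0 := by
    simp only [Trq, QuaternionAlgebra.re_add] at *; linarith
  have s1 := hsq x x' htx hsimx
  have s2 := hsq y y' hty hsimy
  have s3 := hsq (x + y) (x' + y') htxy hsimxy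
  have q1 := aux_sq p q x htx
  have q2 := aux_sq p q y hty
  have q3 := aux_sq p q (x + y) htxy
  have t1 : x * y + y * x = algebraMap ℚ (Bq p q) (-(Nrq (x + y)) - -(Nrq x) - -(Nrq y)) := by
    rw [map_sub, map_sub, ← q1, ← q2, ← q3]; noncomm_ring
  have t2 : x' * y' + y' * x' = x * y + y * x := by
    have e : x' * y' + y' * x' = (x' + y') * (x' + y') - x' * x' - y' * y' := by noncomm_ring
    rw [e, s1, s2, s3]; noncomm_ring
  obtain ⟨d, hd, hdx⟩ := hsimx
  obtain ⟨i1, i2⟩ := inv d hd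
  have hxd : x = qinv d * x' * d := by
    rw [← hdx]
    calc x = (qinv d * d) * x * (qinv d * d) := by rw [i2]; simp
      _ = _ := by simp only [mul_assoc]
  have hmul : ∀ v w : Bq p q, (qinv d * v * d) * (qinv d * w * d) = qinv d * (v * w) * d := by
    intro v w
    calc (qinv d * v * d) * (qinv d * w * d) = qinv d * v * (d * qinv d) * w * d := by
          simp only [mul_assoc]
      _ = _ := by rw [i1]; simp only [mul_assoc, one_mul]
  have hsc : ∀ r : ℚ, qinv d * algebraMap ℚ (Bq p q) r * d = algebraMap ℚ (Bq p q) r := by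
    intro r
    rw [← Algebra.commutes, mul_assoc, i2, mul_one]
  have hx0 : x ≠ 0 := by simpa using hxy.ne_zero 0
  obtain ⟨e, he, hex, hey⟩ := aux_conj x y (qinv d * y' * d) _ _ _ q1 q2
    (by rw [hmul, s2, q2, hsc]) t1
    (by
      have : x * (qinv d * y' * d) + qinv d * y' * d * x = qinv d * (x' * y' + y' * x') * d := by
        rw [hxd, hmul, hmul, mul_add, add_mul]
      rw [this, t2, t1, hsc]) hx0
    (fun r s h => (LinearIndependent.pair_iff.1 hxy r s h).2)
  have hde : d * e ≠ 0 := mul_ne_zero hd he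
  obtain ⟨j1, j2⟩ := inv _ hde
  have cx : d * e * x * qinv (d * e) = x' := by
    have : d * e * x = x' * (d * e) := by
      rw [mul_assoc, hex, ← mul_assoc, hxd]
      simp only [← mul_assoc]
      rw [i1, one_mul]
    rw [this, mul_assoc, j1, mul_one]
  have cy : d * e * y * qinv (d * e) = y' := by
    have : d * e * y = y' * (d * e) := by
      rw [mul_assoc, hey]
      simp only [← mul_assoc]
      rw [i1, one_mul]
    rw [this, mul_assoc, j1, mul_one]
  have hlin : ∀ a b : ℤ, d * e * (a • x + b • y) * qinv (d * e) = a • x' + b • y' := by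
    intro a b
    rw [mul_add, add_mul, mul_smul_comm, mul_smul_comm, smul_mul_assoc, smul_mul_assoc, cx, cy]
  refine ⟨d * e, hde, ?_⟩
  ext t
  constructor
  · rintro ⟨_, ⟨a, b, rfl⟩, rfl⟩
    exact ⟨a, b, hlin a b⟩
  · rintro ⟨a, b, rfl⟩
    exact ⟨_, ⟨a, b, rfl⟩, hlin a b⟩
end

section
/- Let O and O′ be maximal orders of B_p such that the same elements x, y realize the first two successive minima of both O^T and O′^T (i.e. x = x′ and y = y′ in the standard notation). If there exists w ∈ O′^T with w ∉ ℤx + ℤy and Nr(w) = D₃, the third successive minimum of O^T, then {x, y, w} is a ℤ-basis of O′^T, i.e. O′^T = ℤx + ℤy + ℤw. -/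
open scoped Quaternion

open GrossPaper
open GrossPaper
namespace GB
variable {p q : ℕ}

/-- `pq` times the determinant of imaginary parts. -/
def dl (u v w : Bq p q) : ℚ := p * q * (u.imI * (v.imJ * w.imK - v.imK * w.imJ)
  + u.imJ * (v.imK * w.imI - v.imI * w.imK) + u.imK * (v.imI * w.imJ - v.imJ * w.imI))

/-- pairing on the trace zero part -/
def pr (u v : Bq p q) : ℚ := p * (u.imI * v.imI) + q * (u.imJ * v.imJ) + p * q * (u.imK * v.imK)

lemma Nrq_eq (u : Bq p q) : Nrq u = u.re ^ 2 + p * u.imI ^ 2 + q * u.imJ ^ 2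
    + p * q * u.imK ^ 2 := by
  simp [Nrq]; ring

lemma Nrq_nonneg (u : Bq p q) : 0 ≤ Nrq u := by rw [Nrq_eq]; positivity

lemma Nrq_eq_zero (hp : 0 < p) (hq : 0 < q) {u : Bq p q} (h : Nrq u = 0) : u = 0 := by
  have hp' : (0:ℚ) < p := by exact_mod_cast hp
  have hq' : (0:ℚ) < q := by exact_mod_cast hq
  rw [Nrq_eq] at h
  have h1 : 0 ≤ u.re ^ 2 := by positivity
  have h2 : 0 ≤ p * u.imI ^ 2 := by positivity
  have h3 : 0 ≤ q * u.imJ ^ 2 := by positivity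
  have h4 : 0 ≤ p * q * u.imK ^ 2 := by positivity
  have e1 : u.re ^ 2 = 0 := by linarith
  have e2 : p * u.imI ^ 2 = 0 := by linarith
  have e3 : q * u.imJ ^ 2 = 0 := by linarith
  have e4 : p * q * u.imK ^ 2 = 0 := by linarith
  ext <;> simp_all [hp'.ne', hq'.ne']

lemma Nrq_mul (u v : Bq p q) : Nrq (u * v) = Nrq u * Nrq v := by
  simp [Nrq_eq]; ring

lemma Nrq_pow (u : Bq p q) (k : ℕ) : Nrq (u ^ k) = Nrq u ^ k := by
  induction k with
  | zero => simp [Nrq_eq]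
  | succ k ih => rw [pow_succ, Nrq_mul, ih, pow_succ]

lemma dl_trace (u v w : Bq p q) : Trq ((u * v - v * u) * star w) = 4 * dl u v w := by
  simp [Trq, dl]; ring

lemma dl_disc (a c : Bq p q) : 4 * dl a c (a * c) =
    -(Trq a ^ 2 * Nrq c + Trq c ^ 2 * Nrq a + Trq (a * c) ^ 2 - Trq a * Trq c * Trq (a * c)
      - 4 * Nrq a * Nrq c) := by
  simp [Trq, dl, Nrq_eq]; ring

lemma resid (x y t : Bq p q) (hx : x.re = 0) (hy : y.re = 0) (ht : t.re = 0) :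
    (Nrq x * Nrq y - pr x y ^ 2) * Nrq t = dl x y t ^ 2 +
    ((pr t x * Nrq y - pr t y * pr x y) * pr t x + (pr t y * Nrq x - pr t x * pr x y) * pr t y) := by
  simp [Nrq_eq, pr, dl, hx, hy, ht]; ring

lemma resid2 (x y t : Bq p q) (hx : x.re = 0) (hy : y.re = 0) (ht : t.re = 0) :
    Nrq ((Nrq x * Nrq y - pr x y ^ 2) • t - (pr t x * Nrq y - pr t y * pr x y) • x
      - (pr t y * Nrq x - pr t x * pr x y) • y) =
    (Nrq x * Nrq y - pr x y ^ 2) * dl x y t ^ 2 := by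
  simp [Nrq_eq, pr, dl, hx, hy, ht]; ring

lemma Nrq_comb (x y : Bq p q) (hx : x.re = 0) (hy : y.re = 0) (a b : ℚ) :
    Nrq (a • x + b • y) = a ^ 2 * Nrq x + 2 * (a * b) * pr x y + b ^ 2 * Nrq y := by
  simp [Nrq_eq, pr, hx, hy]; ring

lemma gram_pos (hp : 0 < p) (hq : 0 < q) (x y : Bq p q) (hx : x.re = 0) (hy : y.re = 0)
    (hxy : LinearIndependent ℚ ![x, y]) : 0 < Nrq x ∧ 0 < Nrq x * Nrq y - pr x y ^ 2 := by
  rw [LinearIndependent.pair_iff] at hxy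
  have h1 : 0 < Nrq x := by
    rcases (Nrq_nonneg x).lt_or_eq with h | h
    · exact h
    · have := Nrq_eq_zero hp hq h.symm
      have := hxy 1 0 (by simp [this])
      simp at this
  refine ⟨h1, ?_⟩
  have h2 : Nrq ((-pr x y) • x + (Nrq x) • y) = Nrq x * (Nrq x * Nrq y - pr x y ^ 2) := by
    rw [Nrq_comb x y hx hy]; ring
  have h3 : 0 < Nrq ((-pr x y) • x + (Nrq x) • y) := by
    rcases (Nrq_nonneg ((-pr x y) • x + (Nrq x) • y)).lt_or_eq with h | h
    · exact h
    · have := hxy _ _ (Nrq_eq_zero hp hq h.symm)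
      exact absurd this.2 h1.ne'
  rw [h2] at h3
  exact (mul_pos_iff_of_pos_left h1).1 h3

/-- kernel of `dl x y` is the plane -/
lemma ker_dl (hp : 0 < p) (hq : 0 < q) (x y t : Bq p q) (hx : x.re = 0) (hy : y.re = 0)
    (ht : t.re = 0) (hxy : LinearIndependent ℚ ![x, y]) (h : dl x y t = 0) :
    ∃ a b : ℚ, t = a • x + b • y := by
  have hG := (gram_pos hp hq x y hx hy hxy).2
  have h1 := resid2 x y t hx hy ht
  rw [h] at h1
  have h2 := Nrq_eq_zero hp hq (h1.trans (by ring))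
  set G := Nrq x * Nrq y - pr x y ^ 2 with hGd
  refine ⟨G⁻¹ * (pr t x * Nrq y - pr t y * pr x y), G⁻¹ * (pr t y * Nrq x - pr t x * pr x y), ?_⟩
  have h3 : G • t = (pr t x * Nrq y - pr t y * pr x y) • x
      + (pr t y * Nrq x - pr t x * pr x y) • y := by
    rw [sub_sub, sub_eq_zero] at h2; exact h2
  rw [mul_smul, mul_smul, ← smul_add, ← h3, smul_smul, inv_mul_cancel₀ hG.ne', one_smul]

/-! ### integrality -/

lemma exists_denom (O : Subring (Bq p q)) (hO : IsOrder O) :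
    ∃ d : ℕ, 0 < d ∧ ∀ u ∈ O, ∃ a b c e : ℤ, (d:ℚ) * u.re = a ∧ (d:ℚ) * u.imI = b ∧
      (d:ℚ) * u.imJ = c ∧ (d:ℚ) * u.imK = e := by
  obtain ⟨⟨B⟩, -⟩ := hO
  have key : ∀ f : Bq p q →ₗ[ℤ] ℚ, ∃ d : ℕ, 0 < d ∧ ∀ u ∈ O, ∃ a : ℤ, (d:ℚ) * f u = a := by
    intro f
    refine ⟨∏ i, (f (B i)).den, Finset.prod_pos (fun i _ => Rat.den_pos _), ?_⟩
    intro u hu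
    have h1 : u = ∑ i, (B.repr ⟨u, hu⟩ i) • (B i : Bq p q) := by
      have := congrArg (Subtype.val) (B.sum_repr ⟨u, hu⟩)
      simpa using this.symm
    have h2 : ∀ i, ∃ a : ℤ, ((∏ i, (f (B i)).den : ℕ) : ℚ) * f (B i) = a := by
      intro i
      obtain ⟨k, hk⟩ := Finset.dvd_prod_of_mem (fun i => (f (B i)).den) (Finset.mem_univ i)
      refine ⟨k * (f (B i)).num, ?_⟩
      rw [hk]
      push_cast
      rw [mul_right_comm, Rat.den_mul_eq_num]; ring
    choose g hg using h2
    refine ⟨∑ i, (B.repr ⟨u, hu⟩ i) * g i, ?_⟩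
    conv_lhs => rw [h1]
    rw [map_sum, Finset.mul_sum]
    push_cast
    refine Finset.sum_congr rfl fun i _ => ?_
    rw [← hg i, map_smul, zsmul_eq_mul]; push_cast; ring
  obtain ⟨d1, h1, k1⟩ := key ⟨⟨fun u => u.re, fun _ _ => by simp⟩, fun _ _ => by simp⟩
  obtain ⟨d2, h2, k2⟩ := key ⟨⟨fun u => u.imI, fun _ _ => by simp⟩, fun _ _ => by simp⟩
  obtain ⟨d3, h3, k3⟩ := key ⟨⟨fun u => u.imJ, fun _ _ => by simp⟩, fun _ _ => by simp⟩
  obtain ⟨d4, h4, k4⟩ := key ⟨⟨fun u => u.imK, fun _ _ => by simp⟩, fun _ _ => by simp⟩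
  refine ⟨d1 * d2 * d3 * d4, by positivity, fun u hu => ?_⟩
  obtain ⟨a, ha⟩ := k1 u hu
  obtain ⟨b, hb⟩ := k2 u hu
  obtain ⟨c, hc⟩ := k3 u hu
  obtain ⟨e, he⟩ := k4 u hu
  refine ⟨d2 * d3 * d4 * a, d1 * d3 * d4 * b, d1 * d2 * d4 * c, d1 * d2 * d3 * e, ?_, ?_, ?_, ?_⟩ <;>
    push_cast
  · rw [← ha]; simp; ring
  · rw [← hb]; simp; ring
  · rw [← hc]; simp; ring
  · rw [← he]; simp; ring

lemma Nrq_int (O : Subring (Bq p q)) (hO : IsOrder O) {u : Bq p q} (hu : u ∈ O) :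
    ∃ n : ℤ, Nrq u = n := by
  obtain ⟨d, hd, h⟩ := exists_denom O hO
  have h1 : ∀ k : ℕ, (Nrq u).den ^ k ∣ d ^ 2 := by
    intro k
    obtain ⟨a, b, c, e, ha, hb, hc, he⟩ := h (u ^ k) (pow_mem hu k)
    have h2 : (d ^ 2 : ℚ) * Nrq u ^ k = ((a ^ 2 + p * b ^ 2 + q * c ^ 2 + p * q * e ^ 2 : ℤ) : ℚ) := by
      push_cast
      rw [← Nrq_pow, Nrq_eq, ← ha, ← hb, ← hc, ← he]; ring
    have h3 : (((d ^ 2 : ℕ) : ℤ) * (Nrq u ^ k).num) =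
        (a ^ 2 + p * b ^ 2 + q * c ^ 2 + p * q * e ^ 2 : ℤ) * ((Nrq u ^ k).den : ℤ) := by
      have h4 : (Nrq u ^ k) * (Nrq u ^ k).den = (Nrq u ^ k).num := Rat.mul_den_eq_num _
      have : (((((d ^ 2 : ℕ) : ℤ) * (Nrq u ^ k).num) : ℤ) : ℚ) =
        (((a ^ 2 + p * b ^ 2 + q * c ^ 2 + p * q * e ^ 2 : ℤ) * ((Nrq u ^ k).den : ℤ) : ℤ) : ℚ) := by
        rw [Int.cast_mul, Int.cast_mul, ← h2, ← h4]; push_cast; ring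
      exact_mod_cast this
    rw [← Rat.den_pow]
    have h5 : ((Nrq u ^ k).den : ℤ) ∣ ((d ^ 2 : ℕ) : ℤ) * (Nrq u ^ k).num := ⟨_, h3.trans (mul_comm _ _)⟩
    have h6 := (Nrq u ^ k).reduced.symm
    have h7 : (Nrq u ^ k).den ∣ d ^ 2 * (Nrq u ^ k).num.natAbs := by
      have := Int.natAbs_dvd_natAbs.2 h5
      rwa [Int.natAbs_mul, Int.natAbs_natCast, Int.natAbs_natCast] at this
    exact h6.dvd_of_dvd_mul_right h7
  have h8 : (Nrq u).den = 1 := by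
    by_contra hne
    have h2 : 2 ≤ (Nrq u).den := by have := (Nrq u).den_pos; omega
    have := Nat.le_of_dvd (by positivity) (h1 (d ^ 2))
    have h9 : d ^ 2 < 2 ^ (d ^ 2) := Nat.lt_two_pow_self
    have := Nat.pow_le_pow_left h2 (d ^ 2)
    omega
  exact ⟨(Nrq u).num, by conv_lhs => rw [← Rat.num_div_den (Nrq u), h8]
                         simp⟩

lemma Trq_int (O : Subring (Bq p q)) (hO : IsOrder O) {u : Bq p q} (hu : u ∈ O) :
    ∃ n : ℤ, Trq u = n := by
  obtain ⟨a, ha⟩ := Nrq_int O hO hu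
  obtain ⟨b, hb⟩ := Nrq_int O hO (add_mem hu (one_mem O))
  refine ⟨b - a - 1, ?_⟩
  push_cast
  rw [← ha, ← hb]
  simp [Nrq_eq, Trq]; ring

lemma star_eq (u : Bq p q) : star u = algebraMap ℚ (Bq p q) (Trq u) - u := by
  ext <;> simp [Trq, QuaternionAlgebra.algebraMap_eq] <;> ring

lemma int_mem (O : Subring (Bq p q)) (n : ℤ) : algebraMap ℚ (Bq p q) (n : ℚ) ∈ O := by
  rw [map_intCast]; exact intCast_mem O n

lemma star_mem' (O : Subring (Bq p q)) (hO : IsOrder O) {u : Bq p q} (hu : u ∈ O) :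
    star u ∈ O := by
  obtain ⟨n, hn⟩ := Trq_int O hO hu
  rw [star_eq, hn]
  exact sub_mem (int_mem O n) hu

lemma dl_int (O : Subring (Bq p q)) (hO : IsOrder O) {u v w : Bq p q} (hu : u ∈ O) (hv : v ∈ O)
    (hw : w ∈ O) : ∃ n : ℤ, 4 * dl u v w = n := by
  rw [← dl_trace]
  exact Trq_int O hO (mul_mem (sub_mem (mul_mem hu hv) (mul_mem hv hu)) (star_mem' O hO hw))

lemma exists_mul_mem (O : Subring (Bq p q)) (hO : IsOrder O) (b : Bq p q) :
    ∃ n : ℕ, 0 < n ∧ (n : Bq p q) * b ∈ O := by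
  have hb : b ∈ Submodule.span ℚ (O : Set (Bq p q)) := by rw [hO.2]; trivial
  induction hb using Submodule.span_induction with
  | mem x h => exact ⟨1, one_pos, by simpa using h⟩
  | zero => exact ⟨1, one_pos, by simp⟩
  | add x y _ _ hx hy =>
    obtain ⟨n, hn, h1⟩ := hx
    obtain ⟨m, hm, h2⟩ := hy
    refine ⟨n * m, by positivity, ?_⟩
    have : ((n * m : ℕ) : Bq p q) * (x + y) = (m : Bq p q) * ((n : Bq p q) * x)
        + (n : Bq p q) * ((m : Bq p q) * y) := by
      rw [mul_add, ← mul_assoc, ← mul_assoc]; norm_cast; rw [mul_comm m n]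
    rw [this]
    exact add_mem (mul_mem (natCast_mem O m) h1) (mul_mem (natCast_mem O n) h2)
  | smul r x _ hx =>
    obtain ⟨n, hn, h1⟩ := hx
    refine ⟨n * r.den, Nat.mul_pos hn r.den_pos, ?_⟩
    have : ((n * r.den : ℕ) : Bq p q) * (r • x) = (r.num : Bq p q) * ((n : Bq p q) * x) := by
      have h2 : ((n * r.den : ℕ) : Bq p q) * (r • x) = ((n * r.den : ℕ) : ℚ) • (r • x) := by
        rw [Algebra.smul_def ((n * r.den : ℕ) : ℚ), map_natCast]
      have h3 : (r.num : Bq p q) * ((n : Bq p q) * x) = (r.num : ℚ) • ((n : ℚ) • x) := by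
        rw [Algebra.smul_def, Algebra.smul_def, map_natCast, map_intCast]
      rw [h2, h3, smul_smul, smul_smul, ← Rat.mul_den_eq_num r]
      push_cast
      congr 1; ring
    rw [this]
    exact mul_mem (intCast_mem O _) h1
end GB
namespace GB
variable {p q : ℕ}

lemma bc_form (b c : Bq p q) : b * c = (algebraMap ℚ (Bq p q) (Trq (b * c))
    - algebraMap ℚ (Bq p q) (Trq b) * star c) + star c * b := by
  ext <;> simp [Trq, QuaternionAlgebra.algebraMap_eq] <;> ring

lemma bb_form (b : Bq p q) : b * b = algebraMap ℚ (Bq p q) (Trq b) * b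
    - algebraMap ℚ (Bq p q) (Nrq b) := by
  ext <;> simp [Trq, Nrq_eq, QuaternionAlgebra.algebraMap_eq] <;> ring

lemma enlarge (O : Subring (Bq p q)) (hO : IsMaximalOrder O) (l : ℕ) (hl : 0 < l) (b : Bq p q)
    (hb : b ∉ O) (hlb : (l : Bq p q) * b ∈ O) (ht : ∃ k : ℤ, Trq b = k) (hn : ∃ k : ℤ, Nrq b = k) :
    ∃ c ∈ O, ¬ ∃ k : ℤ, Trq (b * c) = k := by
  by_contra hcon
  push Not at hcon
  obtain ⟨t, ht⟩ := ht
  obtain ⟨n, hn⟩ := hn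
  have hbc : ∀ c ∈ O, ∃ o ∈ O, b * c = o + star c * b := by
    intro c hc
    obtain ⟨k, hk⟩ := hcon c hc
    refine ⟨_, ?_, bc_form b c⟩
    rw [hk, ht]
    exact sub_mem (int_mem O k) (mul_mem (int_mem O t) (star_mem' O hO.1 hc))
  let O2 : Subring (Bq p q) :=
    { carrier := {u | ∃ c ∈ O, ∃ d ∈ O, u = c + d * b}
      zero_mem' := ⟨0, zero_mem O, 0, zero_mem O, by simp⟩
      one_mem' := ⟨1, one_mem O, 0, zero_mem O, by simp⟩
      neg_mem' := by
        rintro _ ⟨c, hc, d, hd, rfl⟩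
        exact ⟨-c, neg_mem hc, -d, neg_mem hd, by noncomm_ring⟩
      add_mem' := by
        rintro _ _ ⟨c, hc, d, hd, rfl⟩ ⟨c', hc', d', hd', rfl⟩
        exact ⟨c + c', add_mem hc hc', d + d', add_mem hd hd', by noncomm_ring⟩
      mul_mem' := by
        rintro _ _ ⟨c, hc, d, hd, rfl⟩ ⟨c', hc', d', hd', rfl⟩
        obtain ⟨o1, ho1, e1⟩ := hbc c' hc'
        obtain ⟨o2, ho2, e2⟩ := hbc d' hd'
        have e3 := bb_form b
        rw [ht, hn] at e3
        have hT := int_mem O t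
        have hN := int_mem O n
        have s1 := star_mem' O hO.1 hc'
        have s2 := star_mem' O hO.1 hd'
        refine ⟨c * c' + d * o1 - d * star d' * algebraMap ℚ (Bq p q) (n : ℚ), ?_,
          c * d' + d * star c' + d * o2 + d * star d' * algebraMap ℚ (Bq p q) (t : ℚ), ?_, ?_⟩
        · exact sub_mem (add_mem (mul_mem hc hc') (mul_mem hd ho1)) (mul_mem (mul_mem hd s2) hN)
        · exact add_mem (add_mem (add_mem (mul_mem hc hd') (mul_mem hd s1)) (mul_mem hd ho2))
            (mul_mem (mul_mem hd s2) hT)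
        · have : (c + d * b) * (c' + d' * b) = c * c' + c * d' * b + d * (b * c')
              + d * (b * d') * b := by noncomm_ring
          rw [this, e1, e2]
          have : c * c' + c * d' * b + d * (o1 + star c' * b) + d * (o2 + star d' * b) * b
            = c * c' + c * d' * b + d * (o1 + star c' * b) + d * o2 * b + d * star d' * (b * b) := by
            noncomm_ring
          rw [this, e3]
          noncomm_ring }
  have hle : O ≤ O2 := fun u hu => ⟨u, hu, 0, zero_mem O, by simp⟩
  have hb2 : b ∈ O2 := ⟨0, zero_mem O, 1, one_mem O, by simp⟩
  have hmul : ∀ u ∈ O2, (l : Bq p q) * u ∈ O := by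
    rintro _ ⟨c, hc, d, hd, rfl⟩
    have : (l : Bq p q) * (c + d * b) = (l : Bq p q) * c + d * ((l : Bq p q) * b) := by
      rw [mul_add, ← mul_assoc, ← mul_assoc, (Nat.cast_commute l d).eq]
    rw [this]
    exact add_mem (mul_mem (natCast_mem O l) hc) (mul_mem hd hlb)
  have hord : IsOrder O2 := by
    refine ⟨?_, ?_⟩
    · obtain ⟨⟨B⟩, -⟩ := hO.1
      have : Module.Finite ℤ O := Module.Finite.of_basis B
      have : Module.Free ℤ O := Module.Free.of_basis B
      let f : O2 →ₗ[ℤ] O :=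
        { toFun := fun u => ⟨(l : Bq p q) * u.1, hmul u.1 u.2⟩
          map_add' := fun u v => by ext1; simp [mul_add]
          map_smul' := fun r u => by
            ext1
            simp only [zsmul_eq_mul, Subring.coe_mul, Subring.coe_intCast, RingHom.id_apply]
            rw [← mul_assoc, (Nat.cast_commute l (r : Bq p q)).eq, mul_assoc] }
      have hf : Function.Injective f := by
        intro u v h
        have h1 : (l : Bq p q) * u.1 = (l : Bq p q) * v.1 := congrArg Subtype.val h
        have h2 : (l : ℚ) • u.1 = (l : ℚ) • v.1 := by
          rw [Algebra.smul_def, Algebra.smul_def, map_natCast]; exact h1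
        have h3 : (l : ℚ) ≠ 0 := by exact_mod_cast hl.ne'
        exact Subtype.ext (smul_right_injective _ h3 h2)
      let g : O →ₗ[ℤ] O2 :=
        { toFun := fun u => ⟨u.1, hle u.2⟩
          map_add' := fun u v => rfl
          map_smul' := fun r u => by ext1; simp }
      have hg : Function.Injective g := by
        intro u v h
        exact Subtype.ext (congrArg (fun z : O2 => z.1) h)
      have : Module.Finite ℤ O2 := Module.Finite.of_injective f hf
      have : Module.Free ℤ O2 := Module.Free.of_equiv (LinearEquiv.ofInjective f hf).symm
      have r1 := LinearMap.finrank_le_finrank_of_injective hf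
      have r2 := LinearMap.finrank_le_finrank_of_injective hg
      have r3 : Module.finrank ℤ O = 4 := by simpa using Module.finrank_eq_card_basis B
      exact ⟨Module.finBasisOfFinrankEq ℤ O2 (by omega)⟩
    · rw [eq_top_iff, ← hO.1.2]
      exact Submodule.span_mono hle
  have := hO.2 O2 hord hle
  rw [this] at hb2
  exact hb hb2

/-! ### Gross lattice -/

lemma gl_re {O : Subring (Bq p q)} {t : Bq p q} (h : t ∈ GrossLat O) : t.re = 0 := by
  obtain ⟨u, -, rfl⟩ := h
  simp [Trq, two_mul]

lemma gl_add {O : Subring (Bq p q)} {s t : Bq p q} (hs : s ∈ GrossLat O) (h : t ∈ GrossLat O) :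
    s + t ∈ GrossLat O := by
  obtain ⟨u, hu, rfl⟩ := h
  obtain ⟨v, hv, rfl⟩ := hs
  refine ⟨v + u, add_mem hv hu, ?_⟩
  ext <;> simp [Trq, two_mul, QuaternionAlgebra.algebraMap_eq] <;> ring

lemma gl_zsmul {O : Subring (Bq p q)} {t : Bq p q} (h : t ∈ GrossLat O) (n : ℤ) :
    n • t ∈ GrossLat O := by
  obtain ⟨u, hu, rfl⟩ := h
  refine ⟨n • u, zsmul_mem hu n, ?_⟩
  ext <;> simp [Trq, two_mul, QuaternionAlgebra.algebraMap_eq] <;> ring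

lemma dl_gross (x y u : Bq p q) : dl x y (2 * u - algebraMap ℚ (Bq p q) (Trq u)) = 2 * dl x y u := by
  simp [dl, Trq, two_mul, QuaternionAlgebra.algebraMap_eq]; ring

lemma dl_gross2 (u v w : Bq p q) : dl (2 * u - algebraMap ℚ (Bq p q) (Trq u))
    (2 * v - algebraMap ℚ (Bq p q) (Trq v)) w = 4 * dl u v w := by
  simp [dl, Trq, two_mul, QuaternionAlgebra.algebraMap_eq]; ring

/-- `x, y` realise the first two minima -/
structure Min2 (O : Subring (Bq p q)) (x y : Bq p q) : Prop where
  hx : x ∈ GrossLat O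
  hy : y ∈ GrossLat O
  hxy : LinearIndependent ℚ ![x, y]
  l1 : ∀ t ∈ GrossLat O, t ≠ 0 → Nrq x ≤ Nrq t
  l2 : ∀ t ∈ GrossLat O, LinearIndependent ℚ ![x, t] → Nrq y ≤ Nrq t

lemma ind_comb {x y : Bq p q} (hxy : LinearIndependent ℚ ![x, y]) (a b : ℚ) (hb : b ≠ 0) :
    LinearIndependent ℚ ![x, a • x + b • y] := by
  rw [LinearIndependent.pair_iff] at hxy ⊢
  intro s t h
  have := hxy (s + t * a) (t * b) (by rw [← h]; module)
  have h2 : t = 0 := by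
    rcases mul_eq_zero.1 this.2 with h | h
    · exact h
    · exact absurd h hb
  refine ⟨?_, h2⟩
  have := this.1
  rw [h2] at this
  simpa using this

lemma plane (hp : 0 < p) (hq : 0 < q) (O : Subring (Bq p q)) (x y : Bq p q) (M : Min2 O x y)
    {t : Bq p q} (ht : t ∈ GrossLat O) (h : dl x y t = 0) :
    ∃ i j : ℤ, t = i • x + j • y := by
  have hx0 := gl_re M.hx
  have hy0 := gl_re M.hy
  obtain ⟨a, b, hab⟩ := ker_dl hp hq x y t hx0 hy0 (gl_re ht) M.hxy h
  obtain ⟨hD1, -⟩ := gram_pos hp hq x y hx0 hy0 M.hxy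
  have hD12 : Nrq x ≤ Nrq y := M.l1 y M.hy (by
    rintro rfl
    have := (LinearIndependent.pair_iff.1 M.hxy) 0 1 (by simp)
    simp at this)
  have hs1 : 0 ≤ Nrq x + 2 * pr x y := by
    have h1 := M.l2 ((1:ℚ) • x + (1:ℚ) • y) (by simpa using gl_add M.hx M.hy)
      (ind_comb M.hxy 1 1 one_ne_zero)
    rw [Nrq_comb x y hx0 hy0] at h1
    linarith
  have hs2 : 0 ≤ Nrq x - 2 * pr x y := by
    have h1 := M.l2 ((-1:ℚ) • x + (1:ℚ) • y)
      (by simpa using gl_add (gl_zsmul M.hx (-1)) M.hy)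
      (ind_comb M.hxy (-1) 1 one_ne_zero)
    rw [Nrq_comb x y hx0 hy0] at h1
    linarith
  set a0 := a - round a with ha0
  set b0 := b - round b with hb0
  have ea := abs_le.1 (abs_sub_round a)
  have eb := abs_le.1 (abs_sub_round b)
  rw [← ha0] at ea
  rw [← hb0] at eb
  have ht0 : a0 • x + b0 • y ∈ GrossLat O := by
    have : a0 • x + b0 • y = t + ((-round a) • x + (-round b) • y) := by
      rw [hab, ha0, hb0, ← Int.cast_smul_eq_zsmul ℚ, ← Int.cast_smul_eq_zsmul ℚ]
      push_cast; module
    rw [this]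
    exact gl_add ht (gl_add (gl_zsmul M.hx _) (gl_zsmul M.hy _))
  have hN := Nrq_comb x y hx0 hy0 a0 b0
  have a2 : a0 ^ 2 ≤ 1 / 4 := by nlinarith
  have b2 : b0 ^ 2 ≤ 1 / 4 := by nlinarith
  have ab1 : a0 * b0 ≤ 1 / 4 := by nlinarith [sq_nonneg (a0 - b0)]
  have ab2 : -(1 / 4) ≤ a0 * b0 := by nlinarith [sq_nonneg (a0 + b0)]
  have hb00 : b0 = 0 := by
    by_contra hne
    have h1 := M.l2 _ ht0 (ind_comb M.hxy a0 b0 hne)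
    rw [hN] at h1
    have k1 : a0 ^ 2 * Nrq x ≤ 1 / 4 * Nrq x := mul_le_mul_of_nonneg_right a2 hD1.le
    have k2 : b0 ^ 2 * Nrq y ≤ 1 / 4 * Nrq y := mul_le_mul_of_nonneg_right b2 (by linarith)
    have k3 : 2 * (a0 * b0) * pr x y ≤ 1 / 4 * Nrq x := by
      rcases le_total 0 (pr x y) with h | h <;> nlinarith
    linarith
  have ha00 : a0 = 0 := by
    by_contra hne
    have h1 := M.l1 _ ht0 (by
      intro h
      exact hne ((LinearIndependent.pair_iff.1 M.hxy) a0 b0 h).1)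
    rw [hN, hb00] at h1
    have k1 : a0 ^ 2 * Nrq x ≤ 1 / 4 * Nrq x := mul_le_mul_of_nonneg_right a2 hD1.le
    linarith
  refine ⟨round a, round b, ?_⟩
  rw [← Int.cast_smul_eq_zsmul ℚ, ← Int.cast_smul_eq_zsmul ℚ, hab]
  congr 2
  · linarith
  · linarith

lemma gen (hp : 0 < p) (hq : 0 < q) (O : Subring (Bq p q)) (hO : IsOrder O) (x y : Bq p q)
    (hx : x ∈ GrossLat O) (hy : y ∈ GrossLat O) (hxy : LinearIndependent ℚ ![x, y]) :
    ∃ N : ℤ, N ≠ 0 ∧ (∃ g ∈ O, dl x y g = N) ∧ ∀ u ∈ O, ∃ k : ℤ, dl x y u = k * N := by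
  have hint : ∀ u ∈ O, ∃ k : ℤ, dl x y u = k := by
    intro u hu
    obtain ⟨a, ha, rfl⟩ := hx
    obtain ⟨b, hb, rfl⟩ := hy
    rw [dl_gross2]
    exact dl_int O hO ha hb hu
  have dadd : ∀ u v, dl x y (u + v) = dl x y u + dl x y v := by
    intro u v; simp [dl]; ring
  have dneg : ∀ u, dl x y (-u) = - dl x y u := by
    intro u; simp [dl]; ring
  let H : AddSubgroup ℤ :=
    { carrier := {k | ∃ u ∈ O, dl x y u = k}
      zero_mem' := ⟨0, zero_mem O, by simp [dl]⟩
      add_mem' := by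
        rintro _ _ ⟨u, hu, h1⟩ ⟨v, hv, h2⟩
        exact ⟨u + v, add_mem hu hv, by rw [dadd, h1, h2]; push_cast; rfl⟩
      neg_mem' := by
        rintro _ ⟨u, hu, h1⟩
        exact ⟨-u, neg_mem hu, by rw [dneg, h1]; push_cast; rfl⟩ }
  obtain ⟨N, hN⟩ := Int.subgroup_cyclic H
  have hNH : N ∈ H := by rw [hN]; exact AddSubgroup.mem_closure_singleton_self N
  have hall : ∀ u ∈ O, ∃ k : ℤ, dl x y u = k * N := by
    intro u hu
    obtain ⟨k, hk⟩ := hint u hu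
    have : k ∈ H := ⟨u, hu, hk⟩
    rw [hN, AddSubgroup.mem_closure_singleton] at this
    obtain ⟨m, hm⟩ := this
    exact ⟨m, by rw [hk, ← hm]; push_cast; simp⟩
  refine ⟨N, ?_, hNH, hall⟩
  rintro rfl
  obtain ⟨n, hn, hmem⟩ := exists_mul_mem O hO (x * y - y * x)
  obtain ⟨k, hk⟩ := hall _ hmem
  have h1 : dl x y ((n : Bq p q) * (x * y - y * x)) = n * (2 * (Nrq x * Nrq y - pr x y ^ 2)) := by
    simp [dl, Nrq_eq, pr, gl_re hx, gl_re hy]; ring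
  rw [h1] at hk
  have := (gram_pos hp hq x y (gl_re hx) (gl_re hy) hxy).2
  have hn' : (0:ℚ) < n := by exact_mod_cast hn
  have : 0 < (n:ℚ) * (2 * (Nrq x * Nrq y - pr x y ^ 2)) := by positivity
  rw [hk] at this
  simp at this
end GB
namespace GB
variable {p q : ℕ}

lemma rep (hp : 0 < p) (hq : 0 < q) (O : Subring (Bq p q)) (x y : Bq p q)
    (M : Min2 O x y) (N : ℤ) (g : Bq p q) (hg : g ∈ O) (hgN : dl x y g = N)
    (hall : ∀ u ∈ O, ∃ k : ℤ, dl x y u = k * N) (u : Bq p q) (hu : u ∈ O) :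
    ∃ i j k : ℤ, u.imI = i / 2 * x.imI + j / 2 * y.imI + k * g.imI ∧
      u.imJ = i / 2 * x.imJ + j / 2 * y.imJ + k * g.imJ ∧
      u.imK = i / 2 * x.imK + j / 2 * y.imK + k * g.imK := by
  obtain ⟨k, hk⟩ := hall u hu
  have h1 : u - k • g ∈ O := sub_mem hu (zsmul_mem hg k)
  have h2 : dl x y (u - k • g) = 0 := by
    have : dl x y (u - k • g) = dl x y u - k * dl x y g := by simp [dl]; ring
    rw [this, hk, hgN]; ring
  obtain ⟨i, j, hij⟩ := plane hp hq O x y M ⟨_, h1, rfl⟩ (by rw [dl_gross, h2, mul_zero])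
  refine ⟨i, j, k, ?_, ?_, ?_⟩
  · have := congrArg (fun z => z.imI) hij
    simp [two_mul, QuaternionAlgebra.algebraMap_eq] at this
    linarith
  · have := congrArg (fun z => z.imJ) hij
    simp [two_mul, QuaternionAlgebra.algebraMap_eq] at this
    linarith
  · have := congrArg (fun z => z.imK) hij
    simp [two_mul, QuaternionAlgebra.algebraMap_eq] at this
    linarith

lemma ddvd (hp : 0 < p) (hq : 0 < q) (O : Subring (Bq p q)) (x y : Bq p q)
    (M : Min2 O x y) (N : ℤ) (g : Bq p q) (hg : g ∈ O) (hgN : dl x y g = N)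
    (hall : ∀ u ∈ O, ∃ k : ℤ, dl x y u = k * N) (u v w : Bq p q) (hu : u ∈ O) (hv : v ∈ O)
    (hw : w ∈ O) : ∃ k : ℤ, 4 * dl u v w = k * N := by
  obtain ⟨a1, a2, a3, ha1, ha2, ha3⟩ := rep hp hq O x y M N g hg hgN hall u hu
  obtain ⟨b1, b2, b3, hb1, hb2, hb3⟩ := rep hp hq O x y M N g hg hgN hall v hv
  obtain ⟨c1, c2, c3, hc1, hc2, hc3⟩ := rep hp hq O x y M N g hg hgN hall w hw
  refine ⟨a1 * (b2 * c3 - b3 * c2) + a2 * (b3 * c1 - b1 * c3) + a3 * (b1 * c2 - b2 * c1), ?_⟩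
  rw [← hgN]
  push_cast
  simp only [dl, ha1, ha2, ha3, hb1, hb2, hb3, hc1, hc2, hc3]
  ring

lemma dvd_of_local (N N' : ℤ) (hN : N ≠ 0)
    (h : ∀ l : ℕ, l.Prime → ∃ m : ℤ, ¬ (l : ℤ) ∣ m ∧ N ∣ m * N') : N ∣ N' := by
  have hpos : 0 < Int.gcd N N' := Int.gcd_pos_of_ne_zero_left _ hN
  obtain ⟨n, n', hc, h1, h2⟩ := Int.exists_gcd_one hpos
  have hg : ((Int.gcd N N' : ℕ) : ℤ) ≠ 0 := by exact_mod_cast hpos.ne'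
  have key : n.natAbs = 1 := by
    by_contra hne
    obtain ⟨l, hl, hln⟩ := Nat.exists_prime_and_dvd hne
    obtain ⟨m, hm, hd⟩ := h l hl
    have h3 : n ∣ m * n' := by
      have : n * (Int.gcd N N' : ℤ) ∣ (m * n') * (Int.gcd N N' : ℤ) := by
        rw [← h1, mul_assoc, ← h2]; exact hd
      exact Int.dvd_of_mul_dvd_mul_right hg this
    have h4 : n ∣ m := Int.dvd_of_dvd_mul_left_of_gcd_one h3 hc
    exact hm ((Int.natCast_dvd.2 hln).trans h4)
  have : n ∣ n' := (Int.isUnit_iff_natAbs_eq.2 key).dvd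
  have := mul_dvd_mul_right this (Int.gcd N N' : ℤ)
  rwa [← h1, ← h2] at this

lemma N_dvd (hp : 0 < p) (hq : 0 < q) (O O' : Subring (Bq p q)) (hO : IsMaximalOrder O)
    (hO' : IsOrder O') (x y : Bq p q)
    (M : Min2 O x y) (N : ℤ) (hN : N ≠ 0) (g : Bq p q) (hg : g ∈ O) (hgN : dl x y g = N)
    (hall : ∀ u ∈ O, ∃ k : ℤ, dl x y u = k * N) (N' : ℤ) (g' : Bq p q) (hg' : g' ∈ O')
    (hgN' : dl x y g' = N') : N ∣ N' := by
  classical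
  refine dvd_of_local N N' hN fun l hl => ?_
  have hex := exists_mul_mem O hO.1 g'
  obtain ⟨hn0, hmem⟩ := Nat.find_spec hex
  set n0 := Nat.find hex with hn0d
  by_cases hdiv : l ∣ n0
  · obtain ⟨n1, hn1⟩ := hdiv
    have hn1pos : 0 < n1 := by
      rcases Nat.eq_zero_or_pos n1 with h | h
      · rw [h] at hn1; omega
      · exact h
    have hlt : n1 < n0 := by rw [hn1]; nlinarith [hl.two_le]
    have hb : (n1 : Bq p q) * g' ∉ O := fun h => Nat.find_min hex hlt ⟨hn1pos, h⟩
    have hb' : (n1 : Bq p q) * g' ∈ O' := mul_mem (natCast_mem O' n1) hg'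
    set b := (n1 : Bq p q) * g' with hbd
    have hlb : (l : Bq p q) * b ∈ O := by
      rw [hbd, ← mul_assoc]
      have : ((l : Bq p q) * (n1 : Bq p q)) = (n0 : Bq p q) := by rw [hn1]; push_cast; rfl
      rw [this]; exact hmem
    obtain ⟨tb, htb⟩ := Trq_int O' hO' hb'
    obtain ⟨nb, hnb⟩ := Nrq_int O' hO' hb'
    obtain ⟨c, hc, hcn⟩ := enlarge O hO l hl.pos b hb hlb ⟨tb, htb⟩ ⟨nb, hnb⟩
    obtain ⟨k, hk⟩ := ddvd hp hq O x y M N g hg hgN hall _ c _ hlb hc (mul_mem hlb hc)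
    obtain ⟨C, hC⟩ := Trq_int O hO.1 (mul_mem hlb hc)
    obtain ⟨B, hB⟩ := Trq_int O hO.1 hc
    obtain ⟨m, hm⟩ := Nrq_int O hO.1 hc
    have e1 : Trq ((l : Bq p q) * b) = l * tb := by rw [← htb]; simp [Trq]; ring
    have e2 : Nrq ((l : Bq p q) * b) = l ^ 2 * nb := by rw [← hnb, Nrq_mul]; simp [Nrq_eq]
    have e3 : Trq ((l : Bq p q) * b * c) = l * Trq (b * c) := by simp [Trq]; ring
    have hCl : ¬ (l : ℤ) ∣ C := by
      rintro ⟨r, rfl⟩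
      apply hcn
      refine ⟨r, ?_⟩
      rw [hC] at e3
      push_cast at e3
      have hl0 : (l : ℚ) ≠ 0 := by exact_mod_cast hl.ne_zero
      exact (mul_left_cancel₀ hl0 e3).symm
    refine ⟨N, ?_, dvd_mul_right _ _⟩
    rintro ⟨r, hr⟩
    rw [dl_disc, e1, e2, hC, hB, hm, hr] at hk
    have hk' : C ^ 2 = (l : ℤ) * (-(k * r) - l * tb ^ 2 * m - B ^ 2 * l * nb + tb * B * C
        + 4 * l * nb * m) := by
      have : ((C ^ 2 : ℤ) : ℚ) = (((l : ℤ) * (-(k * r) - l * tb ^ 2 * m - B ^ 2 * l * nb + tb * B * C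
        + 4 * l * nb * m) : ℤ) : ℚ) := by
        push_cast at hk ⊢
        linarith
      exact_mod_cast this
    have hlp : Prime (l : ℤ) := Nat.prime_iff_prime_int.1 hl
    exact hCl (hlp.dvd_of_dvd_pow ⟨_, hk'⟩)
  · refine ⟨n0, by exact_mod_cast hdiv, ?_⟩
    obtain ⟨k, hk⟩ := hall _ hmem
    have : dl x y ((n0 : Bq p q) * g') = n0 * dl x y g' := by simp [dl]; ring
    rw [this, hgN'] at hk
    exact ⟨k, by rw [mul_comm N k]; exact_mod_cast hk⟩

lemma sq_half {a : ℚ} (h1 : -(1 / 2) ≤ a) (h2 : a ≤ 1 / 2) : a ^ 2 ≤ 1 / 4 := by nlinarith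

lemma ind3 {x y t : Bq p q} (hxy : LinearIndependent ℚ ![x, y]) (h : dl x y t ≠ 0) :
    LinearIndependent ℚ ![x, y, t] := by
  rw [Fintype.linearIndependent_iff]
  intro g hg
  rw [Fin.sum_univ_three] at hg
  simp only [Matrix.cons_val] at hg
  have h1 : dl x y (g 0 • x + g 1 • y + g 2 • t) = g 2 * dl x y t := by simp [dl]; ring
  rw [hg] at h1
  have h2 : g 2 = 0 := by
    have h3 : g 2 * dl x y t = 0 := by rw [← h1]; simp [dl]
    exact (mul_eq_zero.1 h3).resolve_right h
  rw [h2, zero_smul, add_zero] at hg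
  have := LinearIndependent.pair_iff.1 hxy _ _ hg
  intro i
  fin_cases i
  · exact this.1
  · exact this.2
  · exact h2

lemma ind2 {x y t : Bq p q} (hxy : LinearIndependent ℚ ![x, y]) (h : dl x y t ≠ 0) :
    LinearIndependent ℚ ![x, t] := by
  rw [LinearIndependent.pair_iff]
  intro a b hab
  have := (Fintype.linearIndependent_iff.1 (ind3 hxy h)) ![a, 0, b] (by
    rw [Fin.sum_univ_three]; simpa using hab)
  exact ⟨this 0, this 2⟩

lemma ne_zero_of_dl {x y t : Bq p q} (h : dl x y t ≠ 0) : t ≠ 0 := by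
  rintro rfl; exact h (by simp [dl])

lemma min2_of (O : Subring (Bq p q)) (D₁ D₂ : ℝ) (x y : Bq p q)
    (hm1 : SuccMin (GrossLat O) 1 D₁) (hm2 : SuccMin (GrossLat O) 2 D₂)
    (hx : x ∈ GrossLat O) (hy : y ∈ GrossLat O)
    (hxD : (Nrq x : ℝ) = D₁) (hyD : (Nrq y : ℝ) = D₂)
    (hxy : LinearIndependent ℚ ![x, y]) : Min2 O x y := by
  have l1 : ∀ t ∈ GrossLat O, t ≠ 0 → Nrq x ≤ Nrq t := by
    intro t ht h0
    have := hm1.2 (show (Nrq t : ℝ) ∈ _ from ⟨![t], by simpa using ht, by simpa using h0, by simp⟩)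
    rw [← hxD] at this
    exact_mod_cast this
  refine ⟨hx, hy, hxy, l1, ?_⟩
  intro t ht hi
  have h1 : Nrq x ≤ Nrq t := l1 t ht (by
    rintro rfl
    have := (LinearIndependent.pair_iff.1 hi) 0 1 (by simp)
    simp at this)
  have := hm2.2 (show (Nrq t : ℝ) ∈ _ from ⟨![x, t], by simp [Fin.forall_fin_two, hx, ht], hi, by
    simp [Fin.forall_fin_two, h1]⟩)
  rw [← hyD] at this
  exact_mod_cast this

end GB

set_option maxHeartbeats 1000000 in
/-- Lemma gen: `{x, y, w}` is a `ℤ`-basis of `O'^T`. -/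
theorem gen_basis (p q : ℕ) (hp : Nat.Prime p) (hodd : Odd p) (hq : Nat.Prime q)
    (hq8 : q % 8 = 3) (hqr : ∃ r : ℤ, (q : ℤ) ∣ r ^ 2 + p)
    (O O' : Subring (Bq p q)) (hO : IsMaximalOrder O) (hO' : IsMaximalOrder O')
    (D₁ D₂ D₃ : ℝ) (x y w : Bq p q)
    (hm1 : SuccMin (GrossLat O) 1 D₁) (hm2 : SuccMin (GrossLat O) 2 D₂)
    (hm3 : SuccMin (GrossLat O) 3 D₃)
    (hm1' : SuccMin (GrossLat O') 1 D₁) (hm2' : SuccMin (GrossLat O') 2 D₂)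
    (hx : x ∈ GrossLat O) (hy : y ∈ GrossLat O)
    (hx' : x ∈ GrossLat O') (hy' : y ∈ GrossLat O')
    (hxD : (Nrq x : ℝ) = D₁) (hyD : (Nrq y : ℝ) = D₂)
    (hxy : LinearIndependent ℚ ![x, y])
    (hw : w ∈ GrossLat O')
    (hwout : w ∉ {t : Bq p q | ∃ a b : ℤ, t = a • x + b • y})
    (hwD : (Nrq w : ℝ) = D₃) :
    GrossLat O' = {t : Bq p q | ∃ a b c : ℤ, t = a • x + b • y + c • w} := by
  have p0 := hp.pos
  have q0 := hq.pos
  have M := GB.min2_of O D₁ D₂ x y hm1 hm2 hx hy hxD hyD hxy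
  have M' := GB.min2_of O' D₁ D₂ x y hm1' hm2' hx' hy' hxD hyD hxy
  have hx0 := GB.gl_re hx
  have hy0 := GB.gl_re hy
  obtain ⟨hD1, hG⟩ := GB.gram_pos p0 q0 x y hx0 hy0 hxy
  obtain ⟨N, hN, ⟨g, hg, hgN⟩, hall⟩ := GB.gen p0 q0 O hO.1 x y hx hy hxy
  obtain ⟨N', hN', ⟨g', hg', hgN'⟩, hall'⟩ := GB.gen p0 q0 O' hO'.1 x y hx' hy' hxy
  have hdvd := GB.N_dvd p0 q0 O O' hO hO'.1 x y M N hN g hg hgN hall N' g' hg' hgN'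
  have hall2 : ∀ t ∈ GrossLat O', ∃ k : ℤ, GB.dl x y t = 2 * (k * N') := by
    rintro _ ⟨u, hu, rfl⟩
    obtain ⟨k, hk⟩ := hall' u hu
    exact ⟨k, by rw [GB.dl_gross, hk]⟩
  obtain ⟨c, hc⟩ := hall2 w hw
  have hc0 : GB.dl x y w ≠ 0 := by
    intro h
    exact hwout (GB.plane p0 q0 O' x y M' hw h)
  have hD23 : Nrq y ≤ Nrq w := M'.l2 w hw (GB.ind2 hxy hc0)
  have hD12 : Nrq x ≤ Nrq y := M.l1 y hy (by
    rintro rfl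
    have := (LinearIndependent.pair_iff.1 hxy) 0 1 (by simp)
    simp at this)
  have l3 : ∀ t ∈ GrossLat O, GB.dl x y t ≠ 0 → Nrq w ≤ Nrq t := by
    intro t ht h
    have h1 := M.l1 t ht (GB.ne_zero_of_dl h)
    have h2 := M.l2 t ht (GB.ind2 hxy h)
    have := hm3.2 (show (Nrq t : ℝ) ∈ _ from ⟨![x, y, t], by
      intro n; fin_cases n
      · exact hx
      · exact hy
      · exact ht, GB.ind3 hxy h, by
      intro n; fin_cases n
      · simpa using h1
      · simpa using h2
      · simp⟩)
    rw [← hwD] at this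
    exact_mod_cast this
  set G := Nrq x * Nrq y - GB.pr x y ^ 2 with hGd
  -- lower bound for w
  have hlow : GB.dl x y w ^ 2 ≤ G * Nrq w := by
    have h1 := GB.resid x y w hx0 hy0 (GB.gl_re hw)
    have h2 : 0 ≤ Nrq x * ((GB.pr w x * Nrq y - GB.pr w y * GB.pr x y) * GB.pr w x
        + (GB.pr w y * Nrq x - GB.pr w x * GB.pr x y) * GB.pr w y) := by
      have : Nrq x * ((GB.pr w x * Nrq y - GB.pr w y * GB.pr x y) * GB.pr w x
        + (GB.pr w y * Nrq x - GB.pr w x * GB.pr x y) * GB.pr w y) =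
        G * GB.pr w x ^ 2 + (GB.pr w y * Nrq x - GB.pr w x * GB.pr x y) ^ 2 := by
        rw [hGd]; ring
      rw [this]; positivity
    have h3 := (mul_nonneg_iff_of_pos_left hD1).1 h2
    rw [h1]; linarith
  -- upper bound
  have hup : G * Nrq w ≤ 8 * (N : ℚ) ^ 2 := by
    set z0 := 2 * g - algebraMap ℚ (Bq p q) (Trq g) with hz0
    have hz0m : z0 ∈ GrossLat O := ⟨g, hg, rfl⟩
    have hz0d : GB.dl x y z0 = 2 * N := by rw [hz0, GB.dl_gross, hgN]
    set mu := (GB.pr z0 y * Nrq x - GB.pr z0 x * GB.pr x y) / G with hmu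
    set j := round mu with hj
    set nu := (GB.pr z0 x - j * GB.pr x y) / Nrq x with hnu
    set i := round nu with hi
    have e1 := abs_le.1 (abs_sub_round mu)
    have e2 := abs_le.1 (abs_sub_round nu)
    rw [← hj] at e1
    rw [← hi] at e2
    set z := z0 + ((-i) • x + (-j) • y) with hz
    have hzm : z ∈ GrossLat O := GB.gl_add hz0m (GB.gl_add (GB.gl_zsmul hx _) (GB.gl_zsmul hy _))
    have hzd : GB.dl x y z = 2 * N := by
      rw [← hz0d, hz]; simp only [GB.dl]; simp; ring_nf; simp
    have hzx : GB.pr z x = GB.pr z0 x - i * Nrq x - j * GB.pr x y := by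
      rw [hz]; simp [GB.pr, GB.Nrq_eq, hx0]; ring
    have hzy : GB.pr z y = GB.pr z0 y - i * GB.pr x y - j * Nrq y := by
      rw [hz]; simp [GB.pr, GB.Nrq_eq, hy0]; ring
    have f1 : GB.pr z x = (nu - i) * Nrq x := by
      rw [hzx, hnu]; field_simp; ring
    have f2 : GB.pr z y * Nrq x - GB.pr z x * GB.pr x y = (mu - j) * G := by
      have : mu * G = GB.pr z0 y * Nrq x - GB.pr z0 x * GB.pr x y := by
        rw [hmu]; field_simp
      rw [sub_mul, this, hzx, hzy, hGd]; ring
    have hr := GB.resid x y z hx0 hy0 (GB.gl_re hzm)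
    rw [← hGd, hzd] at hr
    have hr2 : Nrq x * ((GB.pr z x * Nrq y - GB.pr z y * GB.pr x y) * GB.pr z x
        + (GB.pr z y * Nrq x - GB.pr z x * GB.pr x y) * GB.pr z y) =
        G * GB.pr z x ^ 2 + (GB.pr z y * Nrq x - GB.pr z x * GB.pr x y) ^ 2 := by
      rw [hGd]; ring
    rw [f2] at hr2
    have n2 : (nu - i) ^ 2 ≤ 1 / 4 := GB.sq_half e2.1 e2.2
    have m2 : (mu - j) ^ 2 ≤ 1 / 4 := GB.sq_half e1.1 e1.2
    have hGle : G ≤ Nrq x * Nrq y := by rw [hGd]; exact sub_le_self _ (sq_nonneg _)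
    have hb1 : G * ((nu - i) * Nrq x) ^ 2 ≤ G * Nrq x * (1 / 4 * Nrq x) := by
      have : G * ((nu - i) * Nrq x) ^ 2 = G * Nrq x * ((nu - i) ^ 2 * Nrq x) := by ring
      rw [this]
      gcongr
    have hb2 : ((mu - j) * G) ^ 2 ≤ G * Nrq x * (1 / 4 * Nrq y) := by
      have : ((mu - j) * G) ^ 2 = G * ((mu - j) ^ 2 * G) := by ring
      rw [this]
      have : G * Nrq x * (1 / 4 * Nrq y) = G * (1 / 4 * (Nrq x * Nrq y)) := by ring
      rw [this]
      gcongr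
    have hb3 : Nrq x * (G * Nrq z - (2 * N) ^ 2) ≤ Nrq x * (G * (1 / 2 * Nrq y)) := by
      have h5 : G * Nrq z - (2 * N) ^ 2 = (GB.pr z x * Nrq y - GB.pr z y * GB.pr x y) * GB.pr z x
        + (GB.pr z y * Nrq x - GB.pr z x * GB.pr x y) * GB.pr z y := by rw [hr]; ring
      rw [h5, f2, hr2, f1]
      have : G * Nrq x * (1 / 4 * Nrq x) ≤ G * Nrq x * (1 / 4 * Nrq y) := by gcongr
      linarith
    have hb4 := le_of_mul_le_mul_left hb3 hD1
    have hb5 := l3 z hzm (by rw [hzd]; simpa using hN)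
    have hb6 : G * Nrq w ≤ G * Nrq z := by gcongr
    have hb7 : G * Nrq y ≤ G * Nrq w := by gcongr
    linarith
  -- c = ±1
  have hcN : (2 * (c * N')) ^ 2 ≤ 8 * N ^ 2 := by
    have : (2 * ((c : ℚ) * N')) ^ 2 ≤ 8 * (N : ℚ) ^ 2 := by rw [← hc]; exact hlow.trans hup
    exact_mod_cast this
  have hc1 : c = 1 ∨ c = -1 := by
    obtain ⟨r, rfl⟩ := hdvd
    have hN2 : 0 < N ^ 2 := by positivity
    have h1 : (c * r) ^ 2 * N ^ 2 ≤ 2 * N ^ 2 := by linarith [hcN]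
    have h2 : (c * r) ^ 2 ≤ 2 := le_of_mul_le_mul_right h1 hN2
    have h3 : c * r ≠ 0 := by
      intro h
      apply hc0
      rw [hc]
      have : (c : ℚ) * r = 0 := by exact_mod_cast h
      push_cast
      linear_combination 2 * (N : ℚ) * this
    have h4 : c * r = 1 ∨ c * r = -1 := by
      generalize c * r = e at h2 h3
      clear * - h2 h3
      have : e < 2 := by nlinarith
      have : -2 < e := by nlinarith
      omega
    rcases h4 with h | h
    · exact Int.eq_one_or_neg_one_of_mul_eq_one h
    · exact Int.eq_one_or_neg_one_of_mul_eq_neg_one h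
  have hcc : c * c = 1 := by rcases hc1 with h | h <;> rw [h] <;> rfl
  ext t
  constructor
  · intro ht
    obtain ⟨k, hk⟩ := hall2 t ht
    have hm : t + (-(k * c)) • w ∈ GrossLat O' := GB.gl_add ht (GB.gl_zsmul hw _)
    have hd : GB.dl x y (t + (-(k * c)) • w) = 0 := by
      have h1 : GB.dl x y (t + (-(k * c)) • w) = GB.dl x y t - k * c * GB.dl x y w := by
        simp [GB.dl]; ring
      have h2 : (c : ℚ) * c = 1 := by exact_mod_cast hcc
      rw [h1, hk, hc]
      linear_combination (-2 * (k : ℚ) * N') * h2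
    obtain ⟨a, b, hab⟩ := GB.plane p0 q0 O' x y M' hm hd
    refine ⟨a, b, k * c, ?_⟩
    rw [← hab, neg_smul]; abel
  · rintro ⟨a, b, e, rfl⟩
    exact GB.gl_add (GB.gl_add (GB.gl_zsmul hx' _) (GB.gl_zsmul hy' _)) (GB.gl_zsmul hw _)
end

section
/- Let O be an order of B_p and u, v ∈ O^T. Then the element s := u·v − ½·Tr(u·v) lies in O^T and is orthogonal to u and v with respect to the bilinear form, i.e. Tr(s·ū) = Tr(s·v̄) = 0. -/
open scoped Quaternion

open GrossPaper

theorem aeval_star_int {p q : ℕ} (x : Bq p q) (P : Polynomial ℤ) :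
    Polynomial.aeval (star x) P = star (Polynomial.aeval x P) := by
  induction P using Polynomial.induction_on' with
  | add a b ha hb => simp only [map_add, star_add, ha, hb]
  | monomial n a =>
    simp only [Polynomial.aeval_monomial, star_mul, star_pow, eq_intCast, star_intCast]
    exact (Int.cast_commute a _).eq

theorem trace_int {p q : ℕ} (O : Subring (Bq p q)) (hO : IsOrder O) (x : Bq p q)
    (hx : x ∈ O) : ∃ n : ℤ, Trq x = n := by
  obtain ⟨⟨b⟩, -⟩ := hO
  have hfin : Module.Finite ℤ O := Module.Finite.of_basis b
  have hint0 : IsIntegral ℤ (⟨x, hx⟩ : O) := IsIntegral.of_finite ℤ _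
  have hint : IsIntegral ℤ x := by
    obtain ⟨P, hP, h⟩ := hint0
    refine ⟨P, hP, ?_⟩
    have := congrArg O.subtype h
    rw [Polynomial.hom_eval₂, RingHom.ext_int (O.subtype.comp (algebraMap ℤ O))
      (algebraMap ℤ (Bq p q))] at this
    simpa using this
  have hint' : IsIntegral ℤ (star x) := by
    obtain ⟨P, hP, h⟩ := hint
    refine ⟨P, hP, ?_⟩
    have h2 := aeval_star_int x P
    have h3 : Polynomial.aeval x P = 0 := h
    rw [h3, star_zero] at h2
    exact h2
  have hsum : x + star x = algebraMap ℚ (Bq p q) (Trq x) := by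
    ext <;> simp [Trq, QuaternionAlgebra.algebraMap_eq]
    ring
  have hstar : star x = algebraMap ℚ (Bq p q) (Trq x) - x := by
    rw [← hsum]; abel
  letI : CommRing (Algebra.adjoin ℤ ({x, star x} : Set (Bq p q))) :=
    Algebra.adjoinCommRingOfComm ℤ (by
      have hc : x * star x = star x * x := by
        rw [hstar, mul_sub, sub_mul, Algebra.commutes]
      rintro a (rfl | rfl) b (rfl | rfl)
      · rfl
      · exact hc
      · exact hc.symm
      · rfl)
  let S := Algebra.adjoin ℤ ({x, star x} : Set (Bq p q))
  have m1 : x ∈ S := Algebra.subset_adjoin (by simp)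
  have m2 : star x ∈ S := Algebra.subset_adjoin (by simp)
  have i1 : IsIntegral ℤ (⟨x, m1⟩ : S) :=
    (isIntegral_algHom_iff S.val Subtype.val_injective).mp hint
  have i2 : IsIntegral ℤ (⟨star x, m2⟩ : S) :=
    (isIntegral_algHom_iff S.val Subtype.val_injective).mp hint'
  have i3 : IsIntegral ℤ ((⟨x, m1⟩ : S) + ⟨star x, m2⟩) := i1.add i2
  have i4 : IsIntegral ℤ (x + star x) :=
    (isIntegral_algHom_iff S.val Subtype.val_injective).mpr i3
  rw [hsum] at i4
  have i5 : IsIntegral ℤ (Trq x) :=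
    (isIntegral_algHom_iff ((Algebra.ofId ℚ (Bq p q)).restrictScalars ℤ)
      (algebraMap ℚ (Bq p q)).injective).mp i4
  obtain ⟨n, hn⟩ := IsIntegrallyClosed.isIntegral_iff.mp i5
  exact ⟨n, by simpa using hn.symm⟩

/-- Lemma mult: `uv - ½Tr(uv)` lies in `O^T ∩ ⟨u,v⟩^⊥`. -/
theorem mult_perp (p q : ℕ) (hp : Nat.Prime p) (hodd : Odd p) (hq : Nat.Prime q)
    (hq8 : q % 8 = 3) (hqr : ∃ r : ℤ, (q : ℤ) ∣ r ^ 2 + p)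
    (O : Subring (Bq p q)) (hO : IsOrder O)
    (u v : Bq p q) (hu : u ∈ GrossLat O) (hv : v ∈ GrossLat O) :
    u * v - algebraMap ℚ (Bq p q) ((1 / 2) * Trq (u * v)) ∈ GrossLat O ∧
    Trq ((u * v - algebraMap ℚ (Bq p q) ((1 / 2) * Trq (u * v))) * star u) = 0 ∧
    Trq ((u * v - algebraMap ℚ (Bq p q) ((1 / 2) * Trq (u * v))) * star v) = 0 := by
  obtain ⟨x, hx, rfl⟩ := hu
  obtain ⟨y, hy, rfl⟩ := hv
  obtain ⟨a, ha⟩ := trace_int O hO x hx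
  obtain ⟨b, hb⟩ := trace_int O hO y hy
  refine ⟨⟨(x * y + x * y) - (b : Bq p q) * x - (a : Bq p q) * y, ?_, ?_⟩, ?_, ?_⟩
  · exact sub_mem (sub_mem (add_mem (mul_mem hx hy) (mul_mem hx hy))
      (mul_mem (intCast_mem O b) hx)) (mul_mem (intCast_mem O a) hy)
  · have ea : (a : Bq p q) = algebraMap ℚ (Bq p q) (Trq x) := by rw [ha]; simp
    have eb : (b : Bq p q) = algebraMap ℚ (Bq p q) (Trq y) := by rw [hb]; simp
    rw [ea, eb, two_mul, two_mul, two_mul]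
    ext <;> simp [Trq, QuaternionAlgebra.algebraMap_eq] <;> ring
  · rw [two_mul, two_mul]
    simp [Trq, QuaternionAlgebra.algebraMap_eq]
    ring
  · rw [two_mul, two_mul]
    simp [Trq, QuaternionAlgebra.algebraMap_eq]
    ring
end
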